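/- Let n ≥ 2 and let D be a torsion-free affine connection on ℝⁿ preserving a volume form, with ambient metric 𝐠 on Ω = ℝ_{>0} × ℝⁿ × ℝⁿ × ℝ. Let U = ℝ_{>0} × ℝⁿ × ℝⁿ × ℝ with coordinates (x^0, x^A, y_A, y_0), and let φ : U → Ω be the diffeomorphism φ(x^0, x, y, y_0) = (t, x, p, ρ) with t = x^0, p_A = y_A/(x^0)², ρ = y_0/x^0. Then the pullback of 𝐠 under φ, i.e. the matrix field u ↦ (Dφ(u))ᵀ · 𝐠(φ(u)) · Dφ(u) where Dφ is the Jacobian matrix, equals the Patterson–Walker metric of the Thomas cone connection of D: the symmetric matrix field h on U with nonzero components h_{x^0 y_0} = h_{y_0 x^0} = 1, h_{x^A y_B} = h_{y_B x^A} = δ_{AB}, h_{x^0 x^B} = h_{x^B x^0} = −2 y_B / x^0, and h_{x^A x^B} = −2 ∑_C y_C Γ^C_{AB}(x) + (2 x^0 y_0/(n−1)) Ric_{AB}(x). In particular, the Fefferman–Graham ambient metric of the Patterson–Walker conformal structure of D is itself a Patterson–Walker metric, namely that of the Thomas cone connection. -/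

import Mathlib

open scoped BigOperators

/-- Partial derivative of a function on `ι → ℝ` in coordinate direction `i`. -/
noncomputable def pd {ι : Type} [Fintype ι] [DecidableEq ι] (i : ι)
    (f : (ι → ℝ) → ℝ) (x : ι → ℝ) : ℝ :=
  fderiv ℝ f x (Pi.single i 1)

/-- Ricci curvature of an affine connection given by coefficients `Γ k i j`. -/
noncomputable def ricConn {ι : Type} [Fintype ι] [DecidableEq ι]
    (Γ : ι → ι → ι → (ι → ℝ) → ℝ) (i j : ι) (x : ι → ℝ) : ℝ :=
  (∑ k, pd k (fun y => Γ k i j y) x) - (∑ k, pd i (fun y => Γ k k j y) x)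
    + ∑ k, ∑ l, (Γ k k l x * Γ l i j x - Γ k i l x * Γ l k j x)

/-- Levi-Civita Christoffel symbols of a metric in coordinates. -/
noncomputable def christoffel {ι : Type} [Fintype ι] [DecidableEq ι]
    (G : (ι → ℝ) → Matrix ι ι ℝ) (k i j : ι) (x : ι → ℝ) : ℝ :=
  (1/2) * ∑ l, (G x)⁻¹ k l *
    (pd i (fun y => G y j l) x + pd j (fun y => G y i l) x - pd l (fun y => G y i j) x)

/-- Laplacian of a metric in coordinates, applied to a function. -/
noncomputable def laplacian {ι : Type} [Fintype ι] [DecidableEq ι]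
    (G : (ι → ℝ) → Matrix ι ι ℝ) (F : (ι → ℝ) → ℝ) (x : ι → ℝ) : ℝ :=
  ∑ i, ∑ j, (G x)⁻¹ i j *
    (pd i (fun y => pd j F y) x - ∑ k, christoffel G k i j x * pd k F x)

/-- Lie derivative of a metric along a vector field, in coordinates. -/
noncomputable def lieDeriv {ι : Type} [Fintype ι] [DecidableEq ι]
    (X : ι → (ι → ℝ) → ℝ) (G : (ι → ℝ) → Matrix ι ι ℝ) (i j : ι) (x : ι → ℝ) : ℝ :=
  (∑ k, X k x * pd k (fun y => G y i j) x)
  + (∑ k, pd i (X k) x * G x k j) + ∑ k, pd j (X k) x * G x i k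

/-- Index type for the ambient space: `t`, `x^A`, `p_A`, `ρ`. -/
abbrev AmbIdx (n : ℕ) : Type := Unit ⊕ (Fin n ⊕ (Fin n ⊕ Unit))

def it (n : ℕ) : AmbIdx n := Sum.inl ()
def ix {n : ℕ} (A : Fin n) : AmbIdx n := Sum.inr (Sum.inl A)
def ip {n : ℕ} (A : Fin n) : AmbIdx n := Sum.inr (Sum.inr (Sum.inl A))
def irho (n : ℕ) : AmbIdx n := Sum.inr (Sum.inr (Sum.inr ()))

/-- The `x`-coordinates of an ambient point. -/
def xc {n : ℕ} (u : AmbIdx n → ℝ) : Fin n → ℝ := fun A => u (ix A)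

/-- The ambient metric of the affine connection `Γ`. -/
noncomputable def ambientMetric (n : ℕ) (Γ : Fin n → Fin n → Fin n → (Fin n → ℝ) → ℝ)
    (u : AmbIdx n → ℝ) : Matrix (AmbIdx n) (AmbIdx n) ℝ :=
  Matrix.of fun a b =>
    match a, b with
    | Sum.inl _, Sum.inl _ => 2 * u (irho n)
    | Sum.inl _, Sum.inr (Sum.inr (Sum.inr _)) => u (it n)
    | Sum.inr (Sum.inr (Sum.inr _)), Sum.inl _ => u (it n)
    | Sum.inr (Sum.inl A), Sum.inr (Sum.inr (Sum.inl B)) =>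
        (u (it n))^2 * (if A = B then (1:ℝ) else 0)
    | Sum.inr (Sum.inr (Sum.inl A)), Sum.inr (Sum.inl B) =>
        (u (it n))^2 * (if A = B then (1:ℝ) else 0)
    | Sum.inr (Sum.inl A), Sum.inr (Sum.inl B) =>
        (u (it n))^2 * (-2 * ∑ C, u (ip C) * Γ C A B (xc u)
          + (2 * u (irho n) / ((n:ℝ) - 1)) * ricConn Γ A B (xc u))
    | _, _ => 0

/-- The Patterson–Walker metric of a torsion-free affine connection with
coefficients `Γ`, on the doubled space with coordinates `(x, y)`. -/
noncomputable def pwGen {ι : Type} [Fintype ι] [DecidableEq ι]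
    (Γ : ι → ι → ι → (ι → ℝ) → ℝ) (u : (ι ⊕ ι) → ℝ) : Matrix (ι ⊕ ι) (ι ⊕ ι) ℝ :=
  Matrix.of fun a b =>
    match a, b with
    | Sum.inl i, Sum.inl j => -2 * ∑ k, u (Sum.inr k) * Γ k i j (fun l => u (Sum.inl l))
    | Sum.inl i, Sum.inr j => if i = j then (1:ℝ) else 0
    | Sum.inr i, Sum.inl j => if i = j then (1:ℝ) else 0
    | Sum.inr _, Sum.inr _ => 0

/-- `D` preserves a volume form: there is a smooth positive `v` with
`∑_C Γ^C_{AC} = ∂_A (log v)`. -/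
def PreservesVolume (n : ℕ) (Γ : Fin n → Fin n → Fin n → (Fin n → ℝ) → ℝ) : Prop :=
  ∃ v : (Fin n → ℝ) → ℝ, ContDiff ℝ (⊤ : ℕ∞) v ∧ (∀ x, 0 < v x) ∧
    ∀ (A : Fin n) (x : Fin n → ℝ), (∑ C, Γ C A C x) = pd A (fun y => Real.log (v y)) x

/-- Index type for the Thomas cone: `x^0` and `x^A`. -/
abbrev ThIdx (n : ℕ) : Type := Unit ⊕ Fin n

/-- The Thomas cone connection of the affine connection `Γ`. -/
noncomputable def thomasConn (n : ℕ) (Γ : Fin n → Fin n → Fin n → (Fin n → ℝ) → ℝ) :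
    ThIdx n → ThIdx n → ThIdx n → ((ThIdx n) → ℝ) → ℝ := fun c a b u =>
  match c, a, b with
  | Sum.inr C, Sum.inr A, Sum.inr B => Γ C A B (fun E => u (Sum.inr E))
  | Sum.inl _, Sum.inr A, Sum.inr B =>
      -(u (Sum.inl ()) / ((n:ℝ) - 1)) * ricConn Γ A B (fun E => u (Sum.inr E))
  | Sum.inr B, Sum.inr A, Sum.inl _ => if A = B then 1 / u (Sum.inl ()) else 0
  | Sum.inr B, Sum.inl _, Sum.inr A => if A = B then 1 / u (Sum.inl ()) else 0
  | _, _, _ => 0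

/-- The change of coordinates `φ(x^0, x, y, y_0) = (t, x, p, ρ)` with `t = x^0`,
`p_A = y_A / (x^0)²`, `ρ = y_0 / x^0`.  Here the source coordinates
`(x^0, x^A, y_A, y_0)` are encoded on the index type `AmbIdx n` in the order
`(it, ix, ip, irho)`. -/
noncomputable def coordChange (n : ℕ) (u : AmbIdx n → ℝ) : AmbIdx n → ℝ := fun a =>
  match a with
  | Sum.inl _ => u (it n)
  | Sum.inr (Sum.inl A) => u (ix A)
  | Sum.inr (Sum.inr (Sum.inl A)) => u (ip A) / (u (it n))^2
  | Sum.inr (Sum.inr (Sum.inr _)) => u (irho n) / u (it n)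

/-- The Jacobian matrix of `coordChange` at `u`. -/
noncomputable def coordChangeJacobian (n : ℕ) (u : AmbIdx n → ℝ) :
    Matrix (AmbIdx n) (AmbIdx n) ℝ :=
  Matrix.of fun a b => pd b (fun w => coordChange n w a) u

/-- The Patterson–Walker metric of the Thomas cone connection of `Γ`, written in
the coordinates `(x^0, x^A, y_A, y_0)` on `U = ℝ_{>0} × ℝⁿ × ℝⁿ × ℝ`. -/
noncomputable def thomasPW (n : ℕ) (Γ : Fin n → Fin n → Fin n → (Fin n → ℝ) → ℝ)
    (u : AmbIdx n → ℝ) : Matrix (AmbIdx n) (AmbIdx n) ℝ :=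
  Matrix.of fun a b =>
    match a, b with
    | Sum.inl _, Sum.inr (Sum.inr (Sum.inr _)) => 1
    | Sum.inr (Sum.inr (Sum.inr _)), Sum.inl _ => 1
    | Sum.inr (Sum.inl A), Sum.inr (Sum.inr (Sum.inl B)) => if A = B then (1:ℝ) else 0
    | Sum.inr (Sum.inr (Sum.inl A)), Sum.inr (Sum.inl B) => if A = B then (1:ℝ) else 0
    | Sum.inl _, Sum.inr (Sum.inl B) => -2 * u (ip B) / u (it n)
    | Sum.inr (Sum.inl B), Sum.inl _ => -2 * u (ip B) / u (it n)
    | Sum.inr (Sum.inl A), Sum.inr (Sum.inl B) =>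
        -2 * ∑ C, u (ip C) * Γ C A B (xc u)
          + (2 * u (it n) * u (irho n) / ((n:ℝ) - 1)) * ricConn Γ A B (xc u)
    | _, _ => 0

theorem pd_apply {ι : Type} [Fintype ι] [DecidableEq ι] (b i : ι) (u : ι → ℝ) :
    pd b (fun w => w i) u = (Pi.single b 1 : ι → ℝ) i := by
  rw [pd, (hasFDerivAt_apply (𝕜 := ℝ) i u).fderiv]
  rfl

theorem pd_div_pow {ι : Type} [Fintype ι] [DecidableEq ι] (b i j : ι) (k : ℕ) (u : ι → ℝ)
    (hu : u j ≠ 0) :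
    pd b (fun w => w i / w j ^ k) u =
      ((Pi.single b 1 : ι → ℝ) i * u j ^ k
        - u i * (k * u j ^ (k - 1) * (Pi.single b 1 : ι → ℝ) j)) / (u j ^ k) ^ 2 := by
  have h := (hasFDerivAt_apply (𝕜 := ℝ) i u).mul
    ((hasDerivAt_inv (pow_ne_zero k hu)).comp_hasFDerivAt u
      ((hasFDerivAt_apply (𝕜 := ℝ) j u).pow k))
  have h' : HasFDerivAt (fun w : ι → ℝ => w i / w j ^ k) _ u := h
  rw [pd, h'.fderiv]
  simp
  field_simp
  ring

theorem coordChangeJacobian_eq (n : ℕ) (u : AmbIdx n → ℝ) (hu : u (it n) ≠ 0) :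
    coordChangeJacobian n u = Matrix.of fun a b =>
      match a, b with
      | Sum.inl _, Sum.inl _ => 1
      | Sum.inr (Sum.inl A), Sum.inr (Sum.inl B) => if A = B then 1 else 0
      | Sum.inr (Sum.inr (Sum.inl A)), Sum.inl _ => -2 * u (ip A) / u (it n) ^ 3
      | Sum.inr (Sum.inr (Sum.inl A)), Sum.inr (Sum.inr (Sum.inl B)) =>
          if A = B then 1 / u (it n) ^ 2 else 0
      | Sum.inr (Sum.inr (Sum.inr _)), Sum.inl _ => -u (irho n) / u (it n) ^ 2
      | Sum.inr (Sum.inr (Sum.inr _)), Sum.inr (Sum.inr (Sum.inr _)) => 1 / u (it n)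
      | _, _ => 0 := by
  have hp (A : Fin n) (b : AmbIdx n) := pd_div_pow b (ip A) (it n) 2 u hu
  have hr (b : AmbIdx n) := pd_div_pow b (irho n) (it n) 1 u hu
  simp only [pow_one] at hr
  ext a b
  rcases a with _ | A | A | _ <;> rcases b with _ | B | B | _ <;>
    simp only [coordChangeJacobian, coordChange, Matrix.of_apply, pd_apply, hp, hr] <;>
    simp [it, ix, ip, irho, Pi.single_apply] at hu ⊢
  all_goals first | (split_ifs <;> field_simp <;> simp) | field_simp

set_option maxHeartbeats 1000000 in
/-- Under the change of coordinates `t = x^0`,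
`p_A = y_A/(x^0)²`, `ρ = y_0/x^0`, the ambient metric pulls back to the
Patterson–Walker metric of the Thomas cone connection: the Fefferman–Graham
ambient metric is itself a Patterson–Walker metric. -/
theorem ambient_metric_is_thomas_pw
    (n : ℕ) (hn : 2 ≤ n) (Γ : Fin n → Fin n → Fin n → (Fin n → ℝ) → ℝ)
    (hsmooth : ∀ C A B, ContDiff ℝ (⊤ : ℕ∞) (Γ C A B))
    (hsym : ∀ C A B x, Γ C A B x = Γ C B A x)
    (hvol : PreservesVolume n Γ) :
    ∀ u : AmbIdx n → ℝ, 0 < u (it n) →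
      (coordChangeJacobian n u).transpose
          * ambientMetric n Γ (coordChange n u) * coordChangeJacobian n u
        = thomasPW n Γ u := by
  intro u hu
  have hu' : u (it n) ≠ 0 := hu.ne'
  have hn' : (n : ℝ) - 1 ≠ 0 := sub_ne_zero.mpr (by exact_mod_cast (by omega : n ≠ 1))
  have hxc : xc (coordChange n u) = xc u := rfl
  rw [coordChangeJacobian_eq n u hu']
  ext a b
  rcases a with _ | A | A | _ <;> rcases b with _ | B | B | _ <;>
    simp only [Matrix.mul_apply, Matrix.transpose_apply, Matrix.of_apply, Fintype.sum_sum_type,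
      ambientMetric, thomasPW, hxc]
  all_goals simp [coordChange, it, ip, irho, div_mul_eq_mul_div, ← Finset.sum_div,
    -mul_eq_mul_left_iff] at hu' ⊢
  all_goals try field_simp
  all_goals first | ring1 | simp [eq_comm]
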